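/- arXiv:1809.07293 — 2 statements merged into one kernel-verified Lean document; each statement's English description precedes it below -/
import Mathlib

section
/- Let K be an algebraically closed field of characteristic p > 0, let ℓ = p^k, and let r > s ≥ 1 with n = (ℓ^r−1)/(ℓ−1), m = (ℓ^s−1)/(ℓ−1). Then the Galois group of the trinomial x^n + a·x^m + b over K(a,b), viewed as a permutation group of its n roots, is isomorphic to a subgroup of PGL_r(F_ℓ) acting on the projective space P^{r−1}(F_ℓ). -/
open Polynomial

namespace FiniteField

/-- In a field extension of a finite field `G` with `q` elements, the solutions of `t ^ q = t` lie
in `G`. -/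
theorem exists_algebraMap_eq_of_pow_card_eq {G Ω : Type*} [Field G] [Fintype G] [Field Ω]
    [Algebra G Ω] {t : Ω} (ht : t ^ Fintype.card G = t) : ∃ c : G, algebraMap G Ω c = t := by
  have hsp : (X ^ Fintype.card G - X : G[X]).Splits := by
    simpa [Nat.card_eq_fintype_card] using Polynomial.splits_X_pow_nat_card_sub_X (K := G)
  exact hsp.mem_range_of_isRoot (X_pow_card_sub_X_ne_zero _ Fintype.one_lt_card) (by simp [ht])

/-- The kernel of `y ↦ y ^ q ^ r + a * y ^ q ^ s + b * y`, where `q` is the cardinality of `G` and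
`b ≠ 0`, is an `r`-dimensional `G`-vector space. -/
theorem exists_linearMap_range_eq_roots {G Ω : Type*} [Field G] [Fintype G] [Field Ω]
    [IsAlgClosed Ω] [Algebra G Ω] {r s : ℕ} (hs : 1 ≤ s) (hrs : s < r) (a : Ω) {b : Ω}
    (hb : b ≠ 0) :
    ∃ B : (Fin r → G) →ₗ[G] Ω, Function.Injective B ∧
      ∀ y, (∃ v, B v = y) ↔
        y ^ Fintype.card G ^ r + a * y ^ Fintype.card G ^ s + b * y = 0 := by
  set q := Fintype.card G with hq
  have hq1 : 1 < q := Fintype.one_lt_card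
  have hq0 : (q : Ω) = 0 := by
    rw [← map_natCast (algebraMap G Ω), hq, FiniteField.cast_card_eq_zero, map_zero]
  let φ : Module.End G Ω := (frobeniusAlgHom G Ω).toLinearMap
  have hφ (i : ℕ) (y : Ω) : (φ ^ i) y = y ^ q ^ i := by
    induction i with
    | zero => simp
    | succ i ih =>
      rw [pow_succ', Module.End.mul_apply, ih, pow_succ q, pow_mul]
      rfl
  let L : Module.End G Ω :=
    φ ^ r + LinearMap.mulLeft G a * φ ^ s + LinearMap.mulLeft G b
  have hL (y : Ω) : L y = y ^ q ^ r + a * y ^ q ^ s + b * y := by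
    simp [L, hφ]
  let P : Polynomial Ω := X ^ q ^ r + (C a * X ^ q ^ s + C b * X)
  have hsr : q ^ s < q ^ r := Nat.pow_lt_pow_right hq1 hrs
  have h1s : 1 < q ^ s := Nat.one_lt_pow (by omega) hq1
  have hdeg : (C a * X ^ q ^ s + C b * X : Polynomial Ω).degree < ((q ^ r : ℕ) : WithBot ℕ) := by
    refine (degree_add_le _ _).trans_lt (max_lt ?_ ?_)
    · exact (degree_C_mul_X_pow_le _ _).trans_lt (by exact_mod_cast hsr)
    · exact (degree_C_mul_X_le _).trans_lt (by exact_mod_cast h1s.trans hsr)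
  have hPdeg : P.natDegree = q ^ r := by
    rw [natDegree_add_eq_left_of_degree_lt (by rwa [degree_X_pow]), natDegree_X_pow]
  have hPder : derivative P = C b := by
    have h1 : ((q ^ r : ℕ) : Ω) = 0 := by simp [hq0, show r ≠ 0 by omega]
    have h2 : ((q ^ s : ℕ) : Ω) = 0 := by simp [hq0, show s ≠ 0 by omega]
    simp only [P, derivative_add, derivative_X_pow, derivative_C_mul, derivative_X, h1, h2]
    simp
  have hPsep : P.Separable := by
    rw [Polynomial.Separable, hPder]
    exact ⟨0, C b⁻¹, by rw [zero_mul, zero_add, ← C_mul, inv_mul_cancel₀ hb, C_1]⟩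
  have hP0 : P ≠ 0 := hPsep.ne_zero
  have hset : (LinearMap.ker L : Set Ω) = P.rootSet Ω := by
    ext y
    simp [mem_rootSet, hP0, hL, P, add_assoc]
  have hcard : Nat.card (LinearMap.ker L) = q ^ r := by
    rw [← hPdeg, ← card_rootSet_eq_natDegree (K := Ω) hPsep (IsAlgClosed.splits _),
      ← Nat.card_eq_fintype_card]
    exact congrArg (fun s : Set Ω ↦ Nat.card s) hset
  have : Finite (LinearMap.ker L) :=
    Nat.finite_of_card_ne_zero (by rw [hcard]; positivity)
  have hfin : Module.finrank G (LinearMap.ker L) = r := by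
    have := Module.natCard_eq_pow_finrank (K := G) (V := LinearMap.ker L)
    rw [hcard, Nat.card_eq_fintype_card] at this
    exact (Nat.pow_right_injective hq1 this).symm
  let E : (Fin r → G) ≃ₗ[G] LinearMap.ker L :=
    LinearEquiv.ofFinrankEq _ _ (by rw [hfin, Module.finrank_fin_fun])
  refine ⟨(LinearMap.ker L).subtype ∘ₗ E, ?_, fun y ↦ ?_⟩
  · exact (LinearMap.ker L).injective_subtype.comp E.injective
  · rw [← hL, ← LinearMap.mem_ker]
    constructor
    · rintro ⟨v, rfl⟩
      exact (E v).2
    · intro hy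
      exact ⟨E.symm ⟨y, hy⟩, by simp⟩

end FiniteField

/-- Two nonzero vectors of a linear subspace of a field extension of a finite field `G` with `q`
elements span the same line if and only if they have the same `(q - 1)`-st power. -/
theorem Projectivization.mk_eq_mk_iff_pow_card_sub_one_eq {G Ω V : Type*} [Field G] [Fintype G]
    [Field Ω] [Algebra G Ω] [AddCommGroup V] [Module G V] (B : V →ₗ[G] Ω)
    (hB : Function.Injective B) {v w : V} (hv : v ≠ 0) (hw : w ≠ 0) :
    mk G v hv = mk G w hw ↔ B v ^ (Fintype.card G - 1) = B w ^ (Fintype.card G - 1) := by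
  have hBv : B v ≠ 0 := (map_ne_zero_iff B hB).mpr hv
  have hBw : B w ≠ 0 := (map_ne_zero_iff B hB).mpr hw
  rw [mk_eq_mk_iff']
  constructor
  · rintro ⟨c, rfl⟩
    have hc : c ≠ 0 := fun h ↦ hv (by simp [h])
    rw [map_smul, Algebra.smul_def, mul_pow, ← map_pow,
      FiniteField.pow_card_sub_one_eq_one c hc, map_one, one_mul]
  · intro h
    obtain ⟨c, hc⟩ := FiniteField.exists_algebraMap_eq_of_pow_card_eq (G := G) (t := B v / B w) <| by
      rw [← Nat.sub_add_cancel (Fintype.card_pos (α := G)), pow_succ, div_pow, h,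
        div_self (pow_ne_zero _ hBw), one_mul]
    refine ⟨c, hB ?_⟩
    rw [map_smul, Algebra.smul_def, hc, div_mul_cancel₀ _ hBw]

/-- An injective endomorphism which maps the range of an injective linear map `B` to itself
restricts to a linear automorphism of the source of `B`. -/
theorem LinearMap.exists_linearEquiv_of_forall_mem_range {G Ω V : Type*} [Field G] [Field Ω]
    [Algebra G Ω] [AddCommGroup V] [Module G V] [Module.Finite G V] (B : V →ₗ[G] Ω)
    (hB : Function.Injective B) (τ : Ω →ₗ[G] Ω) (hτ : Function.Injective τ)
    (hτB : ∀ v, ∃ w, B w = τ (B v)) :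
    ∃ g : V ≃ₗ[G] V, ∀ v, B (g v) = τ (B v) := by
  let g : V →ₗ[G] V := (LinearEquiv.ofInjective B hB).symm ∘ₗ
    (τ ∘ₗ B).codRestrict (LinearMap.range B) hτB
  have hg (v : V) : B (g v) = τ (B v) :=
    congrArg Subtype.val ((LinearEquiv.ofInjective B hB).apply_symm_apply _)
  have hginj : Function.Injective g := fun v w h ↦
    hB (hτ (by rw [← hg, ← hg, h]))
  exact ⟨LinearEquiv.ofInjectiveEndo g hginj, hg⟩

/-- The Galois group of a trinomial `X ^ n + a X ^ m + b` with `b ≠ 0` over a field `F` containing a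
finite field `G` with `q` elements, where `n = (q ^ r - 1) / (q - 1)` and
`m = (q ^ s - 1) / (q - 1)`, acts on the roots through linear automorphisms of the projective space
of dimension `r - 1` over `G`. -/
theorem Polynomial.Gal.exists_trinomial_rootSet_equiv_projectivization {F G : Type*} [Field F]
    [Field G] [Fintype G] [Algebra G F] {r s n m : ℕ} (hs : 1 ≤ s) (hrs : s < r)
    (hn : n * (Fintype.card G - 1) + 1 = Fintype.card G ^ r)
    (hm : m * (Fintype.card G - 1) + 1 = Fintype.card G ^ s) {a b : F} (hb : b ≠ 0) {f : F[X]}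
    (hf : f = X ^ n + C a * X ^ m + C b) :
    ∃ e : f.rootSet f.SplittingField ≃ Projectivization G (Fin r → G),
      ∀ σ : f.Gal, ∃ g : (Fin r → G) ≃ₗ[G] (Fin r → G), ∀ (v : Fin r → G) (hv : v ≠ 0),
        e (σ • e.symm (Projectivization.mk G v hv)) =
          Projectivization.mk G (g v) (g.map_ne_zero_iff.mpr hv) := by
  set q := Fintype.card G with hq
  have hq1 : 1 < q := Fintype.one_lt_card
  have h1s : 1 < q ^ s := Nat.one_lt_pow (by omega) hq1
  have h1r : q ^ s < q ^ r := Nat.pow_lt_pow_right hq1 hrs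
  have hm0 : m ≠ 0 := by rintro rfl; omega
  have hn0 : n ≠ 0 := by rintro rfl; omega
  let S := f.SplittingField
  let Ω := AlgebraicClosure S
  have : Algebra.IsAlgebraic F Ω := Algebra.IsAlgebraic.trans F S Ω
  have : IsAlgClosure F Ω := ⟨inferInstance, inferInstance⟩
  have : Normal F Ω := IsAlgClosure.normal F Ω
  have haeval (z : Ω) :
      aeval z f = z ^ n + algebraMap F Ω a * z ^ m + algebraMap F Ω b :=
    (congrArg (aeval z) hf).trans (by simp)
  have hf0 : f ≠ 0 := by
    rintro h
    have := congrArg (eval 0) (hf.symm.trans h)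
    simp [hn0, hm0, hb] at this
  have hbΩ : algebraMap F Ω b ≠ 0 := (_root_.map_ne_zero _).mpr hb
  obtain ⟨B, hB, hBr⟩ := FiniteField.exists_linearMap_range_eq_roots (G := G) hs hrs
    (algebraMap F Ω a) hbΩ
  have hmul (y : Ω) : aeval (y ^ (q - 1)) f * y =
      y ^ q ^ r + algebraMap F Ω a * y ^ q ^ s + algebraMap F Ω b * y := by
    rw [haeval, ← hn, ← hm]
    ring
  have hroot (v : Fin r → G) (hv : v ≠ 0) : aeval (B v ^ (q - 1)) f = 0 :=
    (mul_eq_zero.mp ((hmul _).trans ((hBr _).mp ⟨v, rfl⟩))).resolve_right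
      ((map_ne_zero_iff B hB).mpr hv)
  have : Fact ((f.map (algebraMap F Ω)).Splits) := ⟨IsAlgClosed.splits _⟩
  have hsurjroot (v : Fin r → G) (hv : v ≠ 0) :
      ∃ x : f.rootSet S, algebraMap S Ω x = B v ^ (q - 1) := by
    obtain ⟨x, hx⟩ := (mapRoots_bijective f Ω).2
      ⟨B v ^ (q - 1), (mem_rootSet_of_ne hf0).mpr (hroot v hv)⟩
    exact ⟨x, congrArg Subtype.val hx⟩
  choose ρ hρ using hsurjroot
  have hinj : Function.Injective (algebraMap S Ω) := (algebraMap S Ω).injective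
  have hρ_iff (v w : Fin r → G) (hv : v ≠ 0) (hw : w ≠ 0) :
      ρ v hv = ρ w hw ↔ Projectivization.mk G v hv = Projectivization.mk G w hw := by
    rw [Projectivization.mk_eq_mk_iff_pow_card_sub_one_eq B hB, ← hρ v hv, ← hρ w hw,
      hinj.eq_iff, Subtype.ext_iff]
  let E : Projectivization G (Fin r → G) → f.rootSet S := fun x ↦ ρ x.rep x.rep_nonzero
  have hE (v : Fin r → G) (hv : v ≠ 0) : E (Projectivization.mk G v hv) = ρ v hv :=
    (hρ_iff _ _ _ _).mpr (Projectivization.mk_rep _)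
  have hEbij : Function.Bijective E := by
    constructor
    · intro x y hxy
      simpa using (hρ_iff _ _ _ _).mp hxy
    · intro x
      have hx : aeval (algebraMap S Ω x) f = 0 := by
        rw [aeval_algebraMap_apply, (mem_rootSet.mp x.2).2, map_zero]
      obtain ⟨y, hy⟩ := IsAlgClosed.exists_pow_nat_eq (algebraMap S Ω x) (n := q - 1) (by omega)
      have hy0 : y ≠ 0 := by
        rintro rfl
        rw [zero_pow (by omega)] at hy
        rw [← hy, haeval] at hx
        simp [hn0, hm0, hb] at hx
      obtain ⟨v, rfl⟩ := (hBr y).mpr (by rw [← hmul, hy, hx, zero_mul])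
      have hv : v ≠ 0 := fun h ↦ hy0 (by simp [h])
      refine ⟨Projectivization.mk G v hv, ?_⟩
      rw [hE]
      exact Subtype.ext (hinj ((hρ v hv).trans hy))
  refine ⟨(Equiv.ofBijective E hEbij).symm, fun σ ↦ ?_⟩
  let τ : Ω ≃ₐ[F] Ω := AlgEquiv.liftNormal (F := F) (K₁ := S) σ Ω
  have hτ (x : S) : τ (algebraMap S Ω x) = algebraMap S Ω (σ x) :=
    AlgEquiv.liftNormal_commutes (F := F) (K₁ := S) σ Ω x
  obtain ⟨g, hg⟩ := LinearMap.exists_linearEquiv_of_forall_mem_range B hB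
    (τ.toLinearMap.restrictScalars G) τ.injective fun v ↦ (hBr _).mpr <| by
      simpa using congrArg τ ((hBr (B v)).mp ⟨v, rfl⟩)
  replace hg (v) : B (g v) = τ (B v) := hg v
  refine ⟨g, fun v hv ↦ ?_⟩
  rw [Equiv.symm_symm, Equiv.symm_apply_eq, Equiv.ofBijective_apply, Equiv.ofBijective_apply, hE,
    hE]
  refine Subtype.ext (hinj ?_)
  rw [hρ, hg, ← map_pow, ← hρ v hv, hτ]
  rfl

/-- Let `K` be algebraically closed of characteristic `p > 0`, `ℓ = p^k`, and let
`n = (ℓ^r−1)/(ℓ−1)`, `m = (ℓ^s−1)/(ℓ−1)` with `r > s ≥ 1`. Then the Galois group of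
`x^n + a·x^m + b` over `K(a,b)`, as a permutation group of its roots, is isomorphic to a
subgroup of `PGL_r(F_ℓ)` acting on the projective space `P^{r−1}(F_ℓ)`: the action on the
roots is equivalent to an action on `P^{r−1}(F_ℓ)` by permutations induced by linear
automorphisms. -/
theorem trinomial_gal_subgroup_pgl (K : Type) [Field K] [IsAlgClosed K]
    (p k : ℕ) [Fact p.Prime] [CharP K p] (hk : 1 ≤ k)
    (r s n m : ℕ) (hs : 1 ≤ s) (hrs : s < r)
    (hn : n * (p ^ k - 1) + 1 = (p ^ k) ^ r) (hm : m * (p ^ k - 1) + 1 = (p ^ k) ^ s)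
    (a b : FractionRing (MvPolynomial (Fin 2) K))
    (ha : a = algebraMap (MvPolynomial (Fin 2) K) _ (MvPolynomial.X 0))
    (hb : b = algebraMap (MvPolynomial (Fin 2) K) _ (MvPolynomial.X 1))
    (f : Polynomial (FractionRing (MvPolynomial (Fin 2) K)))
    (hf : f = X ^ n + C a * X ^ m + C b) :
    ∃ (ψ : f.Gal →* Equiv.Perm (Projectivization (GaloisField p k) (Fin r → GaloisField p k)))
      (e : f.rootSet f.SplittingField ≃
            Projectivization (GaloisField p k) (Fin r → GaloisField p k)),
      Function.Injective ψ ∧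
      (∀ (σ : f.Gal) (x : f.rootSet f.SplittingField), e (σ • x) = ψ σ (e x)) ∧
      (∀ σ : f.Gal,
        ∃ g : (Fin r → GaloisField p k) ≃ₗ[GaloisField p k] (Fin r → GaloisField p k),
          ∀ (v : Fin r → GaloisField p k) (hv : v ≠ 0),
            ψ σ (Projectivization.mk _ v hv) =
              Projectivization.mk _ (g v) (g.map_ne_zero_iff.mpr hv)) := by
  have : Fintype (GaloisField p k) := Fintype.ofFinite _
  have hcard : Fintype.card (GaloisField p k) = p ^ k := by
    rw [← Nat.card_eq_fintype_card, GaloisField.card p k (by omega)]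
  have hb0 : b ≠ 0 := by
    rw [hb, Ne, map_eq_zero_iff _ (IsFractionRing.injective (MvPolynomial (Fin 2) K) _)]
    exact MvPolynomial.X_ne_zero 1
  let : Algebra (ZMod p) K := ZMod.algebra K p
  let i : GaloisField p k →ₐ[ZMod p] K := IsAlgClosed.lift
  let : Algebra (GaloisField p k) (FractionRing (MvPolynomial (Fin 2) K)) :=
    ((algebraMap K (FractionRing (MvPolynomial (Fin 2) K))).comp i.toRingHom).toAlgebra
  obtain ⟨e, he⟩ := Gal.exists_trinomial_rootSet_equiv_projectivization (G := GaloisField p k)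
    hs hrs (by rwa [hcard]) (by rwa [hcard]) hb0 hf
  refine ⟨e.permCongrHom.toMonoidHom.comp (MulAction.toPermHom f.Gal (f.rootSet f.SplittingField)),
    e, ?_, fun σ x ↦ ?_, he⟩
  · refine e.permCongrHom.injective.comp fun σ τ h ↦ ?_
    have : Fact ((f.map (algebraMap _ f.SplittingField)).Splits) := ⟨SplittingField.splits f⟩
    ext x hx
    exact congrArg Subtype.val (Equiv.ext_iff.mp h ⟨x, hx⟩)
  · simp [Equiv.permCongrHom]
end

section
/- Let K be an algebraically closed field. Then the Galois group of every finite Galois extension of the formal Laurent series field K((t)) is solvable. -/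
/-- A finite group with a separated filtration whose successive commutators descend is solvable. -/
theorem isSolvable_of_commutator_le {G : Type*} [Group G] [Finite G] (H : ℕ → Subgroup G)
    (h_zero : H 0 = ⊤) (h_comm : ∀ n, ⁅H n, H n⁆ ≤ H (n + 1))
    (h_anti : Antitone H) (h_inf : ⨅ n, H n = ⊥) : Group.IsSolvable G := by
  have hle : ∀ n, derivedSeries G n ≤ H n := by
    intro n
    induction n with
    | zero => simp [h_zero]
    | succ n ih => exact (Subgroup.commutator_mono ih ih).trans (h_comm n)
  have hbot : ∃ n, H n = ⊥ := by
    have hex : ∀ g : G, ∃ n, g ∈ H n → g = 1 := by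
      intro g
      by_contra! hg
      have hmem : g ∈ ⨅ n, H n := Subgroup.mem_iInf.mpr fun n => (hg n).1
      rw [h_inf, Subgroup.mem_bot] at hmem
      exact (hg 0).2 hmem
    choose f hf using hex
    obtain ⟨N, hN⟩ := (Set.finite_range f).bddAbove
    refine ⟨N, (Subgroup.eq_bot_iff_forall _).mpr fun g hg => hf g ?_⟩
    exact h_anti (hN ⟨g, rfl⟩) hg
  obtain ⟨n, hn⟩ := hbot
  exact ⟨⟨n, le_bot_iff.mp (hn ▸ hle n)⟩⟩

section RamificationFiltration

open IsLocalRing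
open scoped commutatorElement

variable {A B : Type*} [CommRing A] [CommRing B] [IsLocalRing B] [Algebra A B]

theorem AlgEquiv.apply_mem_maximalIdeal (σ : B ≃ₐ[A] B) {x : B} (hx : x ∈ maximalIdeal B) :
    σ x ∈ maximalIdeal B := by
  simpa [mem_maximalIdeal] using hx

/-- The subgroup of automorphisms of `B` over `A` acting trivially on `B` modulo the
`(n + 1)`-st power of the maximal ideal. -/
def ramificationFiltration (A B : Type*) [CommRing A] [CommRing B] [IsLocalRing B] [Algebra A B]
    (n : ℕ) : Subgroup (B ≃ₐ[A] B) where
  carrier := {σ | ∀ x, σ x - x ∈ maximalIdeal B ^ (n + 1)}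
  one_mem' x := by simp
  mul_mem' {σ τ} hσ hτ x := by
    simpa using add_mem (hσ (τ x)) (hτ x)
  inv_mem' {σ} hσ x := by
    have hmem := neg_mem (hσ (σ.symm x))
    rw [AlgEquiv.apply_symm_apply, neg_sub] at hmem
    exact hmem

theorem ramificationFiltration_antitone : Antitone (ramificationFiltration A B) :=
  fun _ _ hmn _ hσ x => Ideal.pow_le_pow_right (Nat.succ_le_succ hmn) (hσ x)

theorem iInf_ramificationFiltration [IsNoetherianRing B] :
    ⨅ n, ramificationFiltration A B n = ⊥ := by
  refine (Subgroup.eq_bot_iff_forall _).mpr fun σ hσ => AlgEquiv.ext fun x => ?_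
  rw [Subgroup.mem_iInf] at hσ
  have hmem : σ x - x ∈ ⨅ n, maximalIdeal B ^ n :=
    (Ideal.mem_iInf).mpr fun n => Ideal.pow_le_pow_right n.le_succ (hσ n x)
  rw [Ideal.iInf_pow_eq_bot_of_isLocalRing _ (maximalIdeal.isMaximal B).ne_top,
    Ideal.mem_bot, sub_eq_zero] at hmem
  exact hmem

theorem ramificationFiltration_zero
    (hres : ∀ x : B, ∃ a : A, x - algebraMap A B a ∈ maximalIdeal B) :
    ramificationFiltration A B 0 = ⊤ := by
  refine eq_top_iff.mpr fun σ _ x => ?_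
  obtain ⟨a, ha⟩ := hres x
  rw [zero_add, pow_one]
  have hσ := σ.apply_mem_maximalIdeal ha
  rw [map_sub, AlgEquiv.commutes] at hσ
  convert sub_mem hσ ha using 1
  ring

theorem commutator_mem_ramificationFiltration {n : ℕ} {σ τ : B ≃ₐ[A] B}
    (h : ∀ x, σ (τ x) - τ (σ x) ∈ maximalIdeal B ^ (n + 1)) :
    ⁅σ, τ⁆ ∈ ramificationFiltration A B n := by
  intro x
  have hmem := h ((τ * σ)⁻¹ x)
  have hx : τ (σ ((τ * σ)⁻¹ x)) = x := (τ * σ).apply_symm_apply x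
  rw [hx] at hmem
  rwa [commutatorElement_def, mul_assoc, ← mul_inv_rev]

theorem sub_mem_of_mem_ramificationFiltration {n : ℕ} {σ : B ≃ₐ[A] B}
    (hσ : σ ∈ ramificationFiltration A B n) {x : B} (hx : x ∈ maximalIdeal B ^ 2) :
    σ x - x ∈ maximalIdeal B ^ (n + 2) := by
  rw [pow_two] at hx
  induction hx using Submodule.mul_induction_on' with
  | mem_mul_mem a ha b hb =>
    have heq : σ (a * b) - a * b = (σ a - a) * σ b + (σ b - b) * a := by
      rw [map_mul]; ring
    rw [heq, show n + 2 = (n + 1) + 1 from rfl, pow_succ (maximalIdeal B) (n + 1)]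
    exact add_mem (Ideal.mul_mem_mul (hσ a) (σ.apply_mem_maximalIdeal hb)) (Ideal.mul_mem_mul (hσ b) ha)
  | add a _ b _ iha ihb =>
    convert add_mem iha ihb using 1
    rw [map_add]; ring

theorem commutator_ramificationFiltration_succ_le (n : ℕ) :
    ⁅ramificationFiltration A B (n + 1), ramificationFiltration A B (n + 1)⁆ ≤
      ramificationFiltration A B (n + 2) := by
  rw [Subgroup.commutator_le]
  intro σ hσ τ hτ
  refine commutator_mem_ramificationFiltration fun x => ?_
  have hsq : maximalIdeal B ^ (n + 1 + 1) ≤ maximalIdeal B ^ 2 :=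
    Ideal.pow_le_pow_right (by omega)
  have hστ := sub_mem_of_mem_ramificationFiltration hσ (hsq (hτ x))
  have hτσ := sub_mem_of_mem_ramificationFiltration hτ (hsq (hσ x))
  convert sub_mem hστ hτσ using 1
  rw [map_sub, map_sub]; ring

/-- Automorphisms act on the cotangent space, which is one-dimensional, by commuting scalars. -/
theorem commutator_ramificationFiltration_zero_le
    (hres : ∀ x : B, ∃ a : A, x - algebraMap A B a ∈ maximalIdeal B)
    (hprinc : (maximalIdeal B).IsPrincipal) :
    ⁅ramificationFiltration A B 0, ramificationFiltration A B 0⁆ ≤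
      ramificationFiltration A B 1 := by
  rw [Subgroup.commutator_le]
  intro σ _ τ _
  refine commutator_mem_ramificationFiltration fun x => ?_
  obtain ⟨π, hπ⟩ := hprinc
  replace hπ : maximalIdeal B = Ideal.span {π} := hπ
  have hscalar : ∀ ρ : B ≃ₐ[A] B, ∃ c : A, ∀ y ∈ maximalIdeal B,
      ρ y - algebraMap A B c * y ∈ maximalIdeal B ^ 2 := by
    intro ρ
    have hπ' : π ∈ maximalIdeal B := hπ ▸ Ideal.mem_span_singleton_self π
    obtain ⟨u, hu⟩ := Ideal.mem_span_singleton.mp (hπ ▸ ρ.apply_mem_maximalIdeal hπ')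
    obtain ⟨c, hc⟩ := hres u
    refine ⟨c, fun y hy => ?_⟩
    obtain ⟨z, rfl⟩ := Ideal.mem_span_singleton.mp (hπ ▸ hy)
    obtain ⟨d, hd⟩ := hres z
    have hd' := ρ.apply_mem_maximalIdeal hd
    rw [map_sub, AlgEquiv.commutes] at hd'
    have heq : ρ (π * z) - algebraMap A B c * (π * z) =
        π * (u * (ρ z - algebraMap A B d) + (u - algebraMap A B c) * algebraMap A B d
          - algebraMap A B c * (z - algebraMap A B d)) := by
      rw [map_mul, hu]; ring
    rw [heq, pow_two]
    refine Ideal.mul_mem_mul hπ' (sub_mem (add_mem ?_ ?_) ?_)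
    · exact Ideal.mul_mem_left _ _ hd'
    · exact Ideal.mul_mem_right _ _ hc
    · exact Ideal.mul_mem_left _ _ hd
  obtain ⟨c, hc⟩ := hscalar σ
  obtain ⟨d, hd⟩ := hscalar τ
  obtain ⟨a, ha⟩ := hres x
  set y := x - algebraMap A B a with hy
  have h₁ := hc _ (τ.apply_mem_maximalIdeal ha)
  have h₂ := hd _ (σ.apply_mem_maximalIdeal ha)
  have h₃ := Ideal.mul_mem_left _ (algebraMap A B c) (hd y ha)
  have h₄ := Ideal.mul_mem_left _ (algebraMap A B d) (hc y ha)
  have hx : x = y + algebraMap A B a := by rw [hy]; ring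
  have heq : σ (τ x) - τ (σ x) = σ (τ y) - τ (σ y) := by
    rw [hx]; simp only [map_add, AlgEquiv.commutes]; ring
  rw [heq]
  convert sub_mem (add_mem h₁ h₃) (add_mem h₂ h₄) using 1
  ring

/-- The automorphism group of a totally ramified extension of local rings is solvable, provided
that it is finite. -/
theorem isSolvable_algEquiv_of_maximalIdeal_isPrincipal [IsNoetherianRing B] [Finite (B ≃ₐ[A] B)]
    (hres : ∀ x : B, ∃ a : A, x - algebraMap A B a ∈ maximalIdeal B)
    (hprinc : (maximalIdeal B).IsPrincipal) : Group.IsSolvable (B ≃ₐ[A] B) := by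
  refine isSolvable_of_commutator_le (ramificationFiltration A B)
    (ramificationFiltration_zero hres) ?_ ramificationFiltration_antitone
    iInf_ramificationFiltration
  rintro (_ | n)
  · exact commutator_ramificationFiltration_zero_le hres hprinc
  · exact commutator_ramificationFiltration_succ_le n

end RamificationFiltration

section CompleteLocal

open IsLocalRing Polynomial

universe u

/-- A finite module over an adically complete Noetherian ring is adically complete. -/
theorem IsAdicComplete.of_moduleFinite {R : Type u} [CommRing R] [IsNoetherianRing R]
    (I : Ideal R) [IsAdicComplete I R] (M : Type u) [AddCommGroup M] [Module R M]
    [Module.Finite R M] : IsAdicComplete I M := by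
  rw [← AdicCompletion.of_bijective_iff]
  let e : R ≃ₗ[R] AdicCompletion I R :=
    LinearEquiv.ofBijective (AdicCompletion.of I R) (AdicCompletion.of_bijective_iff.mpr ‹_›)
  have hbij := (AdicCompletion.ofTensorProduct_bijective_of_finite_of_isNoetherian I M).comp
    ((TensorProduct.lid R M).symm.trans (TensorProduct.congr e (.refl R M))).bijective
  convert hbij using 1
  ext x : 1
  have he : e 1 = 1 := rfl
  simp [he]

/-- Idempotents lift along Henselian ideals. -/
theorem HenselianRing.exists_isIdempotentElem_sub_mem {B : Type*} [CommRing B] (I : Ideal B)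
    [HenselianRing B I] {e : B} (he : e * (e - 1) ∈ I) : ∃ a, IsIdempotentElem a ∧ a - e ∈ I := by
  cases subsingleton_or_nontrivial B
  · exact ⟨e, Subsingleton.elim _ _, by rw [sub_self]; exact zero_mem I⟩
  have hmonic : (X ^ 2 - X : B[X]).Monic := monic_X_pow_sub (by rw [degree_X]; norm_num)
  have heval : (X ^ 2 - X : B[X]).eval e ∈ I := by
    rw [eval_sub, eval_pow, eval_X, pow_two, ← mul_sub_one]
    exact he
  have hderiv : (X ^ 2 - X : B[X]).derivative.eval e = 2 * e - 1 := by
    simp [one_add_one_eq_two]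
  have hunit : IsUnit (Ideal.Quotient.mk I ((X ^ 2 - X : B[X]).derivative.eval e)) := by
    rw [hderiv]
    refine IsUnit.of_mul_eq_one (Ideal.Quotient.mk I (2 * e - 1)) ?_
    rw [← map_mul, ← map_one (Ideal.Quotient.mk I), Ideal.Quotient.mk_eq_mk_iff_sub_mem]
    have heq : (2 * e - 1) * (2 * e - 1) - 1 = 4 * (e * (e - 1)) := by ring
    rw [heq]
    exact Ideal.mul_mem_left I 4 he
  obtain ⟨a, ha, hae⟩ := HenselianRing.is_henselian (I := I) _ hmonic e heval hunit
  refine ⟨a, ?_, hae⟩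
  rw [IsRoot, eval_sub, eval_pow, eval_X, pow_two, sub_eq_zero] at ha
  exact ha

/-- A Dedekind domain which is Henselian at a nonzero proper ideal is local. -/
theorem IsDedekindDomain.isLocalRing_of_henselianRing {B : Type*} [CommRing B] [IsDedekindDomain B]
    (I : Ideal B) [HenselianRing B I] (hI_bot : I ≠ ⊥) (hI_top : I ≠ ⊤) : IsLocalRing B := by
  obtain ⟨Q, hQ, hIQ⟩ := Ideal.exists_le_maximal I hI_top
  have hQ_prime : Prime Q :=
    Ideal.prime_of_isPrime (fun h => hI_bot (le_bot_iff.mp (h ▸ hIQ))) hQ.isPrime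
  obtain ⟨J, hJ, hQJ⟩ := (FiniteMultiplicity.of_prime_left hQ_prime
    hI_bot).exists_eq_pow_mul_and_not_dvd
  set n := multiplicity Q I
  have hJ_top : J = ⊤ := by
    by_contra hJ_ne
    have hcop : Q ^ n ⊔ J = ⊤ := by
      refine Ideal.pow_sup_eq_top ?_
      have hlt : Q < Q ⊔ J := le_sup_left.lt_of_ne fun h =>
        hQJ (Ideal.dvd_iff_le.mpr (h ▸ le_sup_right))
      exact hQ.out.2 _ hlt
    obtain ⟨e, he, f, hf, hef⟩ := Submodule.mem_sup.mp ((Ideal.eq_top_iff_one _).mp hcop)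
    have hfe : f = 1 - e := by rw [← hef]; ring
    have heI : e * (e - 1) ∈ I := by
      have hmem := neg_mem (Ideal.mul_mem_mul he hf)
      rw [← hJ] at hmem
      convert hmem using 1
      rw [hfe]; ring
    obtain ⟨a, ha, hae⟩ := HenselianRing.exists_isIdempotentElem_sub_mem I heI
    have hIQn : I ≤ Q ^ n := hJ ▸ Ideal.mul_le_left
    have hIJ : I ≤ J := hJ ▸ Ideal.mul_le_right
    rcases IsIdempotentElem.iff_eq_zero_or_one.mp ha with h0 | h1
    · refine hJ_ne ((Ideal.eq_top_iff_one _).mpr ?_)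
      have hmem := sub_mem hf (hIJ hae)
      rwa [h0, hfe, zero_sub, sub_neg_eq_add, sub_add_cancel] at hmem
    · have hmem := add_mem (hIQn hae) he
      rw [sub_add_cancel, h1] at hmem
      have hQn : Q ^ n = ⊤ := (Ideal.eq_top_iff_one _).mpr hmem
      refine hQJ (Ideal.dvd_iff_le.mpr ?_)
      rw [hQn, Ideal.top_mul] at hJ
      exact hJ ▸ hIQ
  have hI : I = Q ^ n := by rw [hJ, hJ_top, Ideal.mul_top]
  refine IsLocalRing.of_unique_max_ideal ⟨Q, hQ, fun M hM => ?_⟩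
  have hIM : I ≤ M := by
    refine (HenselianRing.jac (R := B)).trans ?_
    exact sInf_le ⟨bot_le, hM⟩
  have hQM : Q ≤ M := hM.isPrime.le_of_pow_le (hI ▸ hIM)
  exact (hQ.eq_of_le hM.ne_top hQM).symm

/-- Over a complete discrete valuation ring with algebraically closed residue field, finite separable
extensions of the fraction field have solvable automorphism group. -/
theorem isSolvable_gal_of_isAdicComplete (A F L : Type u) [CommRing A] [IsDomain A]
    [IsDiscreteValuationRing A] [IsAdicComplete (maximalIdeal A) A] [IsAlgClosed (ResidueField A)]
    [Field F] [Algebra A F] [IsFractionRing A F] [Field L] [Algebra F L] [Algebra A L]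
    [IsScalarTower A F L] [FiniteDimensional F L] [Algebra.IsSeparable F L] :
    Group.IsSolvable (L ≃ₐ[F] L) := by
  let B := integralClosure A L
  have : IsDedekindDomain B := IsIntegralClosure.isDedekindDomain A F L B
  have : Module.Finite A B := IsIntegralClosure.finite A F L B
  have : FaithfulSMul A L := FaithfulSMul.trans A F L
  let I := (maximalIdeal A).map (algebraMap A B)
  have : IsAdicComplete I B := by
    rw [IsAdicComplete.map_algebraMap_iff]
    exact .of_moduleFinite _ _
  have hI_bot : I ≠ ⊥ := by
    rw [Ne, Ideal.map_eq_bot_iff_of_injective (FaithfulSMul.algebraMap_injective A B)]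
    exact IsDiscreteValuationRing.not_a_field A
  have hI_top : I ≠ ⊤ := by
    rw [Ne, Ideal.map_eq_top_iff (algebraMap A B) (FaithfulSMul.algebraMap_injective A B)
      (algebraMap_isIntegral_iff.mpr inferInstance)]
    exact (maximalIdeal.isMaximal A).ne_top
  have : IsLocalRing B := IsDedekindDomain.isLocalRing_of_henselianRing I hI_bot hI_top
  have hsurj : Function.Surjective (algebraMap (ResidueField A) (ResidueField B)) :=
    IsAlgClosed.algebraMap_bijective_of_isIntegral.2
  have hres : ∀ x : B, ∃ a : A, x - algebraMap A B a ∈ maximalIdeal B := by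
    intro x
    obtain ⟨r, hr⟩ := hsurj (residue B x)
    obtain ⟨a, rfl⟩ := residue_surjective r
    refine ⟨a, ?_⟩
    rw [← residue_eq_zero_iff, map_sub, ← hr, sub_eq_zero]
    rfl
  have hprinc : (maximalIdeal B).IsPrincipal :=
    maximalIdeal_isPrincipal_of_isDedekindDomain B
  let e := galRestrict A F L B
  have : Finite (B ≃ₐ[A] B) := Finite.of_equiv _ e.toEquiv
  have := isSolvable_algEquiv_of_maximalIdeal_isPrincipal hres hprinc
  exact Group.isSolvable_of_isSolvable_injective (f := e.toMonoidHom) e.injective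

end CompleteLocal

/-- Let `K` be an algebraically closed field. Every finite Galois extension of the formal
Laurent series field `K((t))` has solvable Galois group. -/
theorem laurent_series_galois_solvable (K : Type) [Field K] [IsAlgClosed K]
    (L : Type) [Field L] [Algebra (LaurentSeries K) L]
    [FiniteDimensional (LaurentSeries K) L] [IsGalois (LaurentSeries K) L] :
    IsSolvable (L ≃ₐ[LaurentSeries K] L) := by
  let : Algebra (PowerSeries K) L :=
    Algebra.compHom L (algebraMap (PowerSeries K) (LaurentSeries K))
  have : IsScalarTower (PowerSeries K) (LaurentSeries K) L := .of_algebraMap_eq fun _ => rfl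
  have : IsAdicComplete (IsLocalRing.maximalIdeal (PowerSeries K)) (PowerSeries K) := by
    rw [PowerSeries.maximalIdeal_eq_span_X]
    infer_instance
  have : IsAlgClosed (IsLocalRing.ResidueField (PowerSeries K)) :=
    .of_ringEquiv _ _ PowerSeries.residueFieldOfPowerSeries.symm
  exact isSolvable_gal_of_isAdicComplete (PowerSeries K) (LaurentSeries K) L
end
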